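/- Let f : X → X be continuous on a compact metric space and π : X → Y a continuous semiconjugacy to g : Y → Y such that every fiber π⁻¹(y) has zero topological entropy contribution, i.e. h_top(f, π⁻¹(y)) = 0 for all y. Then for every f-invariant ergodic probability measure μ, h_μ(f) = h_{π_*μ}(g). -/

import Mathlib

open MeasureTheory Set Filter

/-- The dynamical refinement of a countable partition `P` (coded as a map `X → ℕ`):
`refinePart f P n` codes the joint partition `P ∨ f⁻¹P ∨ ⋯ ∨ f⁻ⁿP` via `Nat.pair`. -/
noncomputable def refinePart {X : Type*} (f : X → X) (P : X → ℕ) : ℕ → X → ℕ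
  | 0 => P
  | n + 1 => fun x => Nat.pair (P x) (refinePart f P n (f x))

/-- The (Shannon) entropy of a countable partition coded by `P : X → ℕ`. -/
noncomputable def partEntropy {X : Type*} [MeasurableSpace X] (μ : Measure X) (P : X → ℕ) : ℝ :=
  ∑' i : ℕ, Real.negMulLog (μ (P ⁻¹' {i})).toReal

/-- The Kolmogorov–Sinai (metric) entropy of `f` with respect to `μ`, as the supremum over
finite measurable partitions of the entropy rate of the dynamical refinements. -/
noncomputable def kolSinai {X : Type*} [MeasurableSpace X] (f : X → X) (μ : Measure X) : ℝ :=
  ⨆ P : {P : X → ℕ // Measurable P ∧ (Set.range P).Finite},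
    ⨅ n : ℕ, partEntropy μ (refinePart f P.1 n) / (n + 1)

lemma negMulLog_le_of_nonneg {a q : ℝ} (ha : 0 ≤ a) (hq : 0 ≤ q) (h : q = 0 → a = 0) :
    Real.negMulLog a ≤ -a * Real.log q + q - a := by
  rcases ha.eq_or_lt with rfl | ha
  · simpa using hq
  have hq' : 0 < q := hq.lt_of_ne' fun h0 => ha.ne' (h h0)
  have h1 := Real.log_le_sub_one_of_pos (div_pos hq' ha)
  rw [Real.log_div hq'.ne' ha.ne'] at h1
  have h2 := mul_le_mul_of_nonneg_left h1 ha.le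
  have h3 : a * (q / a - 1) = q - a := by field_simp
  rw [Real.negMulLog]
  linarith

lemma negMulLog_sum_le {ι : Type*} (T : Finset ι) (a : ι → ℝ) (ha : ∀ i ∈ T, 0 ≤ a i) :
    Real.negMulLog (∑ i ∈ T, a i) ≤ ∑ i ∈ T, Real.negMulLog (a i) := by
  rw [Real.negMulLog, ← Finset.sum_neg_distrib, Finset.sum_mul]
  refine Finset.sum_le_sum fun i hi => ?_
  rw [Real.negMulLog]
  rcases (ha i hi).eq_or_lt with h0 | h0
  · simp [← h0]
  · have := Real.log_le_log h0 (Finset.single_le_sum ha hi)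
    nlinarith

section Entropy

variable {X : Type*} [MeasurableSpace X] {μ : Measure X}

lemma partEntropy_eq_sum {P : X → ℕ} {T : Finset ℕ} (hT : ∀ x, P x ∈ T) :
    partEntropy μ P = ∑ i ∈ T, Real.negMulLog (μ.real (P ⁻¹' {i})) := by
  refine tsum_eq_sum fun i hi => ?_
  have : P ⁻¹' {i} = ∅ := by
    ext x
    simp only [mem_preimage, mem_singleton_iff, mem_empty_iff_false, iff_false]
    rintro rfl
    exact hi (hT x)
  simp [this]

lemma partEntropy_nonneg [IsProbabilityMeasure μ] (P : X → ℕ) : 0 ≤ partEntropy μ P :=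
  tsum_nonneg fun _ => Real.negMulLog_nonneg ENNReal.toReal_nonneg measureReal_le_one

lemma sum_measureReal_inter_preimage [IsProbabilityMeasure μ] {P : X → ℕ} (hP : Measurable P)
    {T : Finset ℕ} (hT : ∀ x, P x ∈ T) {A : Set X} (hA : MeasurableSet A) :
    ∑ i ∈ T, μ.real (A ∩ P ⁻¹' {i}) = μ.real A := by
  rw [← measureReal_biUnion_finset]
  · congr 1
    ext x
    simp [hT x]
  · intro i _ j _ hij
    refine Set.disjoint_left.2 ?_
    rintro x ⟨_, hi⟩ ⟨_, hj⟩
    exact hij (hi.symm.trans hj)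
  · exact fun i _ => hA.inter (hP (measurableSet_singleton i))

lemma sum_measureReal_preimage [IsProbabilityMeasure μ] {P : X → ℕ} (hP : Measurable P)
    {T : Finset ℕ} (hT : ∀ x, P x ∈ T) : ∑ i ∈ T, μ.real (P ⁻¹' {i}) = 1 := by
  simpa using sum_measureReal_inter_preimage (μ := μ) hP hT MeasurableSet.univ

lemma partEntropy_pair_le [IsProbabilityMeasure μ] {S P : X → ℕ} (hS : Measurable S)
    (hSf : (range S).Finite) (hP : Measurable P) (hPf : (range P).Finite) :
    partEntropy μ (fun x => Nat.pair (S x) (P x)) ≤ partEntropy μ S + partEntropy μ P := by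
  classical
  set TS := hSf.toFinset with hTS
  set TP := hPf.toFinset with hTP
  have hS' : ∀ x, S x ∈ TS := fun x => by simp [hTS]
  have hP' : ∀ x, P x ∈ TP := fun x => by simp [hTP]
  have hpair : ∀ x, Nat.pair (S x) (P x) ∈ (TS ×ˢ TP).image fun q => Nat.pair q.1 q.2 := fun x =>
    Finset.mem_image.2 ⟨(S x, P x), Finset.mem_product.2 ⟨hS' x, hP' x⟩, rfl⟩
  rw [partEntropy_eq_sum hpair, Finset.sum_image (by
    rintro ⟨a, b⟩ _ ⟨c, d⟩ _ h
    simpa [Nat.pair_eq_pair] using h), Finset.sum_product, partEntropy_eq_sum hS',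
    partEntropy_eq_sum hP']
  set a : ℕ → ℝ := fun s => μ.real (S ⁻¹' {s})
  set b : ℕ → ℝ := fun p => μ.real (P ⁻¹' {p})
  set c : ℕ → ℕ → ℝ := fun s p => μ.real (S ⁻¹' {s} ∩ P ⁻¹' {p}) with hc
  have hset : ∀ s p, (fun x => Nat.pair (S x) (P x)) ⁻¹' {Nat.pair s p}
      = S ⁻¹' {s} ∩ P ⁻¹' {p} := fun s p => by
    ext x
    simp [Nat.pair_eq_pair]
  simp only [hset]
  have hca : ∀ s, ∑ p ∈ TP, c s p = a s := fun s =>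
    sum_measureReal_inter_preimage hP hP' (hS (measurableSet_singleton s))
  have hcb : ∀ p, ∑ s ∈ TS, c s p = b p := fun p => by
    simp only [hc, Set.inter_comm]
    exact sum_measureReal_inter_preimage hS hS' (hP (measurableSet_singleton p))
  have ha1 : ∑ s ∈ TS, a s = 1 := sum_measureReal_preimage hS hS'
  have hb1 : ∑ p ∈ TP, b p = 1 := sum_measureReal_preimage hP hP'
  have hle_a : ∀ s p, c s p ≤ a s := fun s p => measureReal_mono inter_subset_left
  have hle_b : ∀ s p, c s p ≤ b p := fun s p => measureReal_mono inter_subset_right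
  have hc0 : ∀ s p, 0 ≤ c s p := fun s p => measureReal_nonneg
  have key : ∀ s p, Real.negMulLog (c s p)
      ≤ -c s p * Real.log (a s) + -c s p * Real.log (b p) + a s * b p - c s p := by
    intro s p
    have ha0 : 0 ≤ a s := measureReal_nonneg
    have hb0 : 0 ≤ b p := measureReal_nonneg
    rcases (hc0 s p).eq_or_lt with h0 | h0
    · simpa [← h0] using mul_nonneg ha0 hb0
    · have ha' := h0.trans_le (hle_a s p)
      have hb' := h0.trans_le (hle_b s p)
      have := negMulLog_le_of_nonneg (hc0 s p) (mul_nonneg ha0 hb0)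
        fun h => absurd h (mul_pos ha' hb').ne'
      rw [Real.log_mul ha'.ne' hb'.ne'] at this
      linarith
  have e1 : ∑ s ∈ TS, ∑ p ∈ TP, -c s p * Real.log (a s) = ∑ s ∈ TS, Real.negMulLog (a s) := by
    refine Finset.sum_congr rfl fun s _ => ?_
    rw [← Finset.sum_mul, Finset.sum_neg_distrib, hca, Real.negMulLog]
  have e2 : ∑ s ∈ TS, ∑ p ∈ TP, -c s p * Real.log (b p) = ∑ p ∈ TP, Real.negMulLog (b p) := by
    rw [Finset.sum_comm]
    refine Finset.sum_congr rfl fun p _ => ?_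
    rw [← Finset.sum_mul, Finset.sum_neg_distrib, hcb, Real.negMulLog]
  have e3 : ∑ s ∈ TS, ∑ p ∈ TP, a s * b p = 1 := by
    simp only [← Finset.mul_sum, hb1, mul_one, ha1]
  have e4 : ∑ s ∈ TS, ∑ p ∈ TP, c s p = 1 := by simp only [hca, ha1]
  calc ∑ s ∈ TS, ∑ p ∈ TP, Real.negMulLog (c s p)
      ≤ ∑ s ∈ TS, ∑ p ∈ TP,
        (-c s p * Real.log (a s) + -c s p * Real.log (b p) + a s * b p - c s p) :=
        Finset.sum_le_sum fun s _ => Finset.sum_le_sum fun p _ => key s p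
    _ = _ := by
      simp only [Finset.sum_sub_distrib, Finset.sum_add_distrib, e1, e2, e3, e4]
      ring

/-- If every atom of `S` meets at most `N` atoms of `P`, then the entropy of `P` exceeds that of
`S` by at most `log N`. -/
lemma partEntropy_le_add_log [IsProbabilityMeasure μ] {S P : X → ℕ} (hS : Measurable S)
    (hSf : (range S).Finite) (hP : Measurable P) (hPf : (range P).Finite) {N : ℝ} (hN : 0 < N)
    (h : ∀ s, ((P '' (S ⁻¹' {s})).ncard : ℝ) ≤ N) :
    partEntropy μ P ≤ partEntropy μ S + Real.log N := by
  classical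
  set TS := hSf.toFinset with hTS
  set TP := hPf.toFinset with hTP
  have hS' : ∀ x, S x ∈ TS := fun x => by simp [hTS]
  have hP' : ∀ x, P x ∈ TP := fun x => by simp [hTP]
  rw [partEntropy_eq_sum hS', partEntropy_eq_sum hP']
  set a : ℕ → ℝ := fun s => μ.real (S ⁻¹' {s})
  set b : ℕ → ℝ := fun p => μ.real (P ⁻¹' {p})
  set c : ℕ → ℕ → ℝ := fun s p => μ.real (S ⁻¹' {s} ∩ P ⁻¹' {p}) with hc
  have hca : ∀ s, ∑ p ∈ TP, c s p = a s := fun s =>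
    sum_measureReal_inter_preimage hP hP' (hS (measurableSet_singleton s))
  have hcb : ∀ p, ∑ s ∈ TS, c s p = b p := fun p => by
    simp only [hc, Set.inter_comm]
    exact sum_measureReal_inter_preimage hS hS' (hP (measurableSet_singleton p))
  have ha1 : ∑ s ∈ TS, a s = 1 := sum_measureReal_preimage hS hS'
  have hc0 : ∀ s p, 0 ≤ c s p := fun s p => measureReal_nonneg
  have ha0 : ∀ s, 0 ≤ a s := fun s => measureReal_nonneg
  have hle_a : ∀ s p, c s p ≤ a s := fun s p => measureReal_mono inter_subset_left
  have atom : ∀ s, ∑ p ∈ TP, Real.negMulLog (c s p)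
      ≤ Real.negMulLog (a s) + a s * Real.log N := by
    intro s
    set T := TP.filter (· ∈ P '' (S ⁻¹' {s})) with hT
    have hzero : ∀ p ∈ TP, p ∉ T → c s p = 0 := by
      intro p hp hpT
      have : S ⁻¹' {s} ∩ P ⁻¹' {p} = ∅ := by
        ext x
        simp only [mem_inter_iff, mem_preimage, mem_singleton_iff, mem_empty_iff_false, iff_false]
        rintro ⟨h1, h2⟩
        exact hpT (Finset.mem_filter.2 ⟨hp, x, h1, h2⟩)
      simp [hc, this]
    have hsub : T ⊆ TP := Finset.filter_subset _ _
    have hcaT : ∑ p ∈ T, c s p = a s := (Finset.sum_subset hsub hzero).trans (hca s)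
    rw [← Finset.sum_subset hsub fun p hp hpT => by rw [hzero p hp hpT, Real.negMulLog_zero]]
    have hcard : (T.card : ℝ) ≤ N := by
      refine le_trans ?_ (h s)
      rw [← Set.ncard_coe_finset]
      exact_mod_cast Set.ncard_le_ncard (fun p hp => (Finset.mem_filter.1 hp).2)
        (hPf.subset (image_subset_range _ _))
    rcases (ha0 s).eq_or_lt with h0 | h0
    · have : ∀ p, c s p = 0 := fun p => le_antisymm ((hle_a s p).trans h0.ge) (hc0 s p)
      simp [this, ← h0]
    have key : ∀ p, Real.negMulLog (c s p)
        ≤ -c s p * Real.log (a s) + c s p * Real.log N + a s / N - c s p := fun p => by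
      have := negMulLog_le_of_nonneg (hc0 s p) (div_pos h0 hN).le
        fun h => absurd h (div_pos h0 hN).ne'
      rw [Real.log_div h0.ne' hN.ne'] at this
      linarith
    refine (Finset.sum_le_sum fun p _ => key p).trans ?_
    rw [Finset.sum_sub_distrib, Finset.sum_add_distrib, Finset.sum_add_distrib, ← Finset.sum_mul,
      ← Finset.sum_mul, Finset.sum_neg_distrib, hcaT, Finset.sum_const, nsmul_eq_mul,
      Real.negMulLog]
    have : T.card * (a s / N) ≤ a s := by
      rw [← mul_div_assoc, div_le_iff₀ hN, mul_comm]
      exact mul_le_mul_of_nonneg_left hcard h0.le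
    linarith
  calc ∑ p ∈ TP, Real.negMulLog (b p)
      ≤ ∑ p ∈ TP, ∑ s ∈ TS, Real.negMulLog (c s p) := Finset.sum_le_sum fun p _ => by
        rw [← hcb p]
        exact negMulLog_sum_le _ _ fun s _ => hc0 s p
    _ = ∑ s ∈ TS, ∑ p ∈ TP, Real.negMulLog (c s p) := Finset.sum_comm
    _ ≤ ∑ s ∈ TS, (Real.negMulLog (a s) + a s * Real.log N) :=
        Finset.sum_le_sum fun s _ => atom s
    _ = _ := by rw [Finset.sum_add_distrib, ← Finset.sum_mul, ha1, one_mul]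

lemma partEntropy_le_of_factors [IsProbabilityMeasure μ] {S P : X → ℕ} (hS : Measurable S)
    (hSf : (range S).Finite) (hP : Measurable P) (hPf : (range P).Finite)
    (h : ∀ x y, S x = S y → P x = P y) : partEntropy μ P ≤ partEntropy μ S := by
  have := partEntropy_le_add_log (μ := μ) hS hSf hP hPf one_pos fun s => by
    have : (P '' (S ⁻¹' {s})).Subsingleton := by
      rintro _ ⟨x, hx, rfl⟩ _ ⟨y, hy, rfl⟩
      exact h x y (hx.trans hy.symm)
    have := this.finite.to_subtype
    exact_mod_cast Set.ncard_le_one_iff_subsingleton.2 ‹_›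
  simpa using this

lemma partEntropy_map {Y : Type*} [MeasurableSpace Y] {φ : X → Y} (hφ : Measurable φ) {Q : Y → ℕ}
    (hQ : Measurable Q) : partEntropy (μ.map φ) Q = partEntropy μ (Q ∘ φ) := by
  simp only [partEntropy, Measure.map_apply hφ (hQ (measurableSet_singleton _)), preimage_comp]

end Entropy

section Refinement

variable {X : Type*} {f : X → X} {P : X → ℕ}

lemma refinePart_eq_iff (n : ℕ) (x y : X) :
    refinePart f P n x = refinePart f P n y ↔ ∀ j ≤ n, P (f^[j] x) = P (f^[j] y) := by
  induction n generalizing x y with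
  | zero => simp [refinePart]
  | succ n ih =>
    simp only [refinePart, Nat.pair_eq_pair, ih]
    constructor
    · rintro ⟨h0, h⟩ (_ | j) hj
      · exact h0
      · exact h j (by omega)
    · exact fun h => ⟨h 0 (by omega), fun j hj => h (j + 1) (by omega)⟩

lemma finite_range_pair {S T : X → ℕ} (hS : (range S).Finite) (hT : (range T).Finite) :
    (range fun x => Nat.pair (S x) (T x)).Finite := by
  refine ((hS.prod hT).image fun q => Nat.pair q.1 q.2).subset ?_
  rintro _ ⟨x, rfl⟩
  exact ⟨(S x, T x), ⟨⟨x, rfl⟩, ⟨x, rfl⟩⟩, rfl⟩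

lemma finite_range_refinePart (hP : (range P).Finite) (n : ℕ) :
    (range (refinePart f P n)).Finite := by
  induction n with
  | zero => exact hP
  | succ n ih => exact finite_range_pair hP (ih.subset (range_comp_subset_range f _))

lemma refinePart_comp {Y : Type*} {g : Y → Y} {φ : X → Y} (h : φ ∘ f = g ∘ φ) (Q : Y → ℕ) (n : ℕ) :
    refinePart g Q n ∘ φ = refinePart f (Q ∘ φ) n := by
  induction n with
  | zero => rfl
  | succ n ih =>
    ext x
    have h1 : φ (f x) = g (φ x) := congrFun h x
    simp only [refinePart, Function.comp_apply, ← ih, h1]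

variable [MeasurableSpace X] {μ : Measure X}

lemma measurable_pair {S T : X → ℕ} (hS : Measurable S) (hT : Measurable T) :
    Measurable fun x => Nat.pair (S x) (T x) :=
  (measurable_of_countable fun q : ℕ × ℕ => Nat.pair q.1 q.2).comp (hS.prodMk hT)

lemma measurable_refinePart (hf : Measurable f) (hP : Measurable P) (n : ℕ) :
    Measurable (refinePart f P n) := by
  induction n with
  | zero => exact hP
  | succ n ih => exact measurable_pair hP (ih.comp hf)

lemma partEntropy_comp (hf : MeasurePreserving f μ μ) (hP : Measurable P) :
    partEntropy μ (P ∘ f) = partEntropy μ P := by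
  rw [← partEntropy_map hf.measurable hP, hf.map_eq]

lemma partEntropy_refinePart_map {Y : Type*} [MeasurableSpace Y] {g : Y → Y} {π : X → Y}
    (hπ : Measurable π) (hg : Measurable g) (hsemi : π ∘ f = g ∘ π) {Q : Y → ℕ} (hQ : Measurable Q)
    (n : ℕ) :
    partEntropy (μ.map π) (refinePart g Q n) = partEntropy μ (refinePart f (Q ∘ π) n) := by
  rw [partEntropy_map hπ (measurable_refinePart hg hQ n), refinePart_comp hsemi]

variable [IsProbabilityMeasure μ]

lemma partEntropy_refinePart_le (hf : MeasurePreserving f μ μ) (hP : Measurable P)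
    (hPf : (range P).Finite) (n : ℕ) :
    partEntropy μ (refinePart f P n) ≤ (n + 1) * partEntropy μ P := by
  induction n with
  | zero => simp [refinePart]
  | succ n ih =>
    have h1 := measurable_refinePart hf.measurable hP n
    have := partEntropy_pair_le (μ := μ) hP hPf (h1.comp hf.measurable)
      ((finite_range_refinePart hPf n).subset (range_comp_subset_range f _))
    rw [partEntropy_comp hf h1] at this
    push_cast
    refine this.trans ?_
    linarith

lemma partEntropy_refinePart_add_le (hf : MeasurePreserving f μ μ) (hP : Measurable P)
    (hPf : (range P).Finite) (m n : ℕ) :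
    partEntropy μ (refinePart f P (m + n + 1))
      ≤ partEntropy μ (refinePart f P m) + partEntropy μ (refinePart f P n) := by
  have hM := fun k => measurable_refinePart hf.measurable hP k
  have hR := fun k => finite_range_refinePart (f := f) hPf k
  have hfm := hf.iterate (m + 1)
  have hMc := (hM n).comp hfm.measurable
  have hRc := (hR n).subset (range_comp_subset_range f^[m + 1] _)
  have h1 := partEntropy_pair_le (μ := μ) (hM m) (hR m) hMc hRc
  rw [partEntropy_comp hfm (hM n)] at h1
  refine le_trans (partEntropy_le_of_factors (measurable_pair (hM m) hMc)
    (finite_range_pair (hR m) hRc) (hM _) (hR _) fun x y h => ?_) h1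
  simp only [Nat.pair_eq_pair, Function.comp_apply, refinePart_eq_iff] at h
  rw [refinePart_eq_iff]
  intro j hj
  by_cases hjm : j ≤ m
  · exact h.1 j hjm
  · obtain ⟨k, rfl⟩ := Nat.exists_eq_add_of_le (show m + 1 ≤ j by omega)
    have := h.2 k (by omega)
    rwa [← Function.iterate_add_apply, ← Function.iterate_add_apply, Nat.add_comm k] at this

lemma bddBelow_entropy_rate (f : X → X) (P : X → ℕ) :
    BddBelow (range fun n : ℕ => partEntropy μ (refinePart f P n) / (n + 1)) :=
  ⟨0, by rintro _ ⟨n, rfl⟩; exact div_nonneg (partEntropy_nonneg _) (by positivity)⟩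

/-- Fekete's lemma for the entropy of the refinements of a finite partition. -/
lemma tendsto_entropy_rate (hf : MeasurePreserving f μ μ) (hP : Measurable P)
    (hPf : (range P).Finite) :
    Tendsto (fun n : ℕ => partEntropy μ (refinePart f P n) / (n + 1)) atTop
      (nhds (⨅ n : ℕ, partEntropy μ (refinePart f P n) / (n + 1))) := by
  let u : ℕ → ℝ := fun k => k.casesOn 0 fun n => partEntropy μ (refinePart f P n)
  have hu : Subadditive u := by
    rintro (_ | m) (_ | n)
    · simp [u]
    · simp [u]
    · simp [u]
    · have := partEntropy_refinePart_add_le hf hP hPf m n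
      have e : m + 1 + (n + 1) = (m + n + 1) + 1 := by ring
      rw [e]
      exact this
  have hb : BddBelow (range fun n => u n / n) := by
    refine ⟨0, ?_⟩
    rintro _ ⟨_ | n, rfl⟩
    · simp [u]
    · exact div_nonneg (partEntropy_nonneg _) (by positivity)
  have ht := (hu.tendsto_lim hb).comp (tendsto_add_atTop_nat 1)
  have hsucc : ∀ n : ℕ, u (n + 1) / ((n + 1 : ℕ) : ℝ)
      = partEntropy μ (refinePart f P n) / (n + 1) := fun n => by simp [u]
  have heq : ((fun n : ℕ => u n / n) ∘ fun n => n + 1)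
      = fun n : ℕ => partEntropy μ (refinePart f P n) / (n + 1) := funext hsucc
  rw [heq] at ht
  have hlim : hu.lim = ⨅ n : ℕ, partEntropy μ (refinePart f P n) / (n + 1) := by
    refine le_antisymm (le_ciInf fun n => ?_) (ge_of_tendsto' ht fun n =>
      ciInf_le (bddBelow_entropy_rate f P) n)
    rw [← hsucc]
    exact hu.lim_le_div hb n.succ_ne_zero
  rwa [hlim] at ht

end Refinement

section Covers

lemma exists_isDynCoverOf_card_le {X : Type*} [UniformSpace X] {f : X → X} {F : Set X}
    (hF : Dynamics.coverEntropy f F ≤ 0) {U : SetRel X X} (hU : U ∈ uniformity X) {δ : ℝ}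
    (hδ : 0 < δ) :
    ∃ m : ℕ, 0 < m ∧ ∃ s : Finset X, Dynamics.IsDynCoverOf f F U m s ∧
      (s.card : ℝ) ≤ Real.exp (δ * m) := by
  have h1 : ExpGrowth.expGrowthSup (fun n : ℕ => (Dynamics.coverMincard f F U n : ENNReal))
      < (δ : EReal) :=
    ((Dynamics.coverEntropyEntourage_le_coverEntropy f F hU).trans hF).trans_lt
      (by exact_mod_cast hδ)
  obtain ⟨m, hm, hm0⟩ :=
    ((ExpGrowth.eventually_le_exp h1).and (eventually_gt_atTop 0)).exists
  have h2 : (δ : EReal) * (m : EReal) = ((δ * m : ℝ) : EReal) := by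
    rw [EReal.coe_mul, EReal.coe_natCast]
  rw [h2, EReal.exp_coe] at hm
  have hlt : Dynamics.coverMincard f F U m < ⊤ := by
    rw [← ENat.toENNReal_lt, ENat.toENNReal_top]
    exact hm.trans_lt ENNReal.ofReal_lt_top
  obtain ⟨s, hs, hcard⟩ := (Dynamics.coverMincard_finite_iff f F U m).1 hlt
  refine ⟨m, hm0, s, hs, ?_⟩
  rw [← hcard] at hm
  have h3 : ENNReal.ofReal (s.card : ℝ) ≤ ENNReal.ofReal (Real.exp (δ * m)) := by
    simpa using hm
  exact (ENNReal.ofReal_le_ofReal_iff (Real.exp_pos _).le).1 h3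

lemma exists_measurable_index {Y : Type*} [TopologicalSpace Y] [CompactSpace Y]
    [Nonempty Y] [MeasurableSpace Y] [OpensMeasurableSpace Y] {W : Y → Set Y}
    (hWo : ∀ y, IsOpen (W y)) (hW : ∀ y, y ∈ W y) :
    ∃ Q : Y → ℕ, Measurable Q ∧ (range Q).Finite ∧ ∃ c : ℕ → Y, ∀ y, y ∈ W (c (Q y)) := by
  classical
  obtain ⟨t, ht⟩ := isCompact_univ.elim_nhds_subcover W fun y _ => (hWo y).mem_nhds (hW y)
  have hcov : ∀ y, ∃ k : Fin t.card, y ∈ W (t.equivFin.symm k) := fun y => by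
    obtain ⟨z, hz, hy⟩ := mem_iUnion₂.1 (ht.2 (mem_univ y))
    exact ⟨t.equivFin ⟨z, hz⟩, by simpa using hy⟩
  let c : ℕ → Y := fun k => if h : k < t.card then t.equivFin.symm ⟨k, h⟩ else Classical.arbitrary Y
  have hc : ∀ y, ∃ k, k < t.card ∧ y ∈ W (c k) := fun y => by
    obtain ⟨k, hk⟩ := hcov y
    exact ⟨k, k.2, by simpa [c] using hk⟩
  refine ⟨fun y => Nat.find (hc y), measurable_find hc fun k =>
    (MeasurableSet.const _).inter (hWo _).measurableSet, ?_, c, fun y => (Nat.find_spec (hc y)).2⟩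
  refine (finite_Iio t.card).subset ?_
  rintro _ ⟨y, rfl⟩
  exact (Nat.find_spec (hc y)).1

variable {X Y : Type*} [UniformSpace X] [CompactSpace X] [TopologicalSpace Y] [T2Space Y]

lemma exists_open_nhds_label {f : X → X} (hf : Continuous f) {π : X → Y} (hπ : Continuous π)
    {y : Y} (hy : Dynamics.coverEntropy f (π ⁻¹' {y}) ≤ 0) {U : Set (X × X)}
    (hU : U ∈ uniformity X) {δ : ℝ} (hδ : 0 < δ) :
    ∃ W : Set Y, IsOpen W ∧ y ∈ W ∧ ∃ m : ℕ, 0 < m ∧ ∃ s : Finset X,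
      (s.card : ℝ) ≤ Real.exp (δ * m) ∧ ∃ l : X → X, (∀ x, π x ∈ W → l x ∈ s) ∧
      ∀ x x', π x ∈ W → π x' ∈ W → l x = l x' → ∀ j < m, (f^[j] x, f^[j] x') ∈ U := by
  classical
  obtain ⟨V, hV, hVo, hVs, hVU⟩ := comp_open_symm_mem_uniformity_sets hU
  obtain ⟨m, hm, s, hs, hcard⟩ := exists_isDynCoverOf_card_le hy hV hδ
  let D := Dynamics.dynEntourage f V m
  have hDo : IsOpen D := isOpen.dynEntourage hf hVo m
  let O : Set X := {x | ∃ c ∈ s, (x, c) ∈ D}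
  have hO : IsOpen O := by
    have : O = ⋃ c ∈ s, (fun x => (x, c)) ⁻¹' D := by
      ext x
      simp [O]
    rw [this]
    exact isOpen_biUnion fun c _ => hDo.preimage (by fun_prop)
  have hfO : π ⁻¹' {y} ⊆ O := fun x hx => by
    obtain ⟨c, hc, h⟩ := hs hx
    exact ⟨c, hc, h⟩
  have hl : ∀ x, ∃ c, x ∈ O → c ∈ s ∧ (x, c) ∈ D := fun x => by
    by_cases hx : x ∈ O
    · obtain ⟨c, hc⟩ := hx
      exact ⟨c, fun _ => hc⟩
    · exact ⟨x, fun h => absurd h hx⟩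
  choose l hl using hl
  have hWO : ∀ x, π x ∈ (π '' Oᶜ)ᶜ → x ∈ O := fun x hx => by
    by_contra h
    exact hx ⟨x, h, rfl⟩
  refine ⟨(π '' Oᶜ)ᶜ, (hπ.isClosedMap _ hO.isClosed_compl).isOpen_compl, ?_, m, hm, s, hcard, l,
    fun x hx => (hl x (hWO x hx)).1, fun x x' hx hx' h j hj => ?_⟩
  · rintro ⟨x, hx, hxy⟩
    exact hx (hfO hxy)
  · have h1 := Dynamics.mem_dynEntourage.1 (hl x (hWO x hx)).2 j hj
    have h2 := Dynamics.mem_dynEntourage.1 (hl x' (hWO x' hx')).2 j hj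
    rw [← h] at h2
    exact hVU ⟨_, h1, hVs.symm _ _ h2⟩

/-- Bowen's covering argument: if all fibers of `π` have zero entropy, there is a finite measurable
partition of the base such that points with the same base itinerary of length `n` are distinguished
at scale `U` by at most `exp (δ * (n + M))` labels. -/
lemma exists_partition_labels [CompactSpace Y] [Nonempty Y] [MeasurableSpace Y]
    [OpensMeasurableSpace Y] {f : X → X} (hf : Continuous f) {π : X → Y} (hπ : Continuous π)
    (hfib : ∀ y, Dynamics.coverEntropy f (π ⁻¹' {y}) ≤ 0) {U : Set (X × X)}
    (hU : U ∈ uniformity X) {δ : ℝ} (hδ : 0 < δ) :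
    ∃ Q : Y → ℕ, Measurable Q ∧ (range Q).Finite ∧ ∃ M : ℕ, ∀ (n : ℕ) (A : Set X),
      (∀ x ∈ A, ∀ x' ∈ A, ∀ j < n, Q (π (f^[j] x)) = Q (π (f^[j] x'))) →
      ∃ (L : X → List X) (T : Finset (List X)), (T.card : ℝ) ≤ Real.exp (δ * (n + M)) ∧
        (∀ x ∈ A, L x ∈ T) ∧
        ∀ x ∈ A, ∀ x' ∈ A, L x = L x' → ∀ j < n, (f^[j] x, f^[j] x') ∈ U := by
  classical
  choose W hWo hW m hm s hs l hls hl using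
    fun y => exists_open_nhds_label hf hπ (hfib y) hU hδ
  obtain ⟨Q, hQ, hQf, c, hc⟩ := exists_measurable_index hWo hW
  obtain ⟨M, hM⟩ := (hQf.image fun k => m (c k)).bddAbove
  have hmM : ∀ y, m (c (Q y)) ≤ M := fun y => hM ⟨Q y, ⟨y, rfl⟩, rfl⟩
  refine ⟨Q, hQ, hQf, M, fun n => ?_⟩
  induction n using Nat.strong_induction_on with
  | _ n ih =>
  intro A hA
  rcases n.eq_zero_or_pos with rfl | hn
  · exact ⟨fun _ => [], {[]}, by simp; positivity, by simp, by simp⟩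
  rcases A.eq_empty_or_nonempty with rfl | ⟨a, ha⟩
  · exact ⟨fun _ => [], ∅, by simp; positivity, by simp, by simp⟩
  set z := c (Q (π a)) with hz
  have hAW : ∀ x ∈ A, π x ∈ W z := fun x hx => by
    rw [hz, ← show Q (π x) = Q (π a) from hA x hx a ha 0 hn]
    exact hc _
  rcases le_or_gt n (m z) with hnm | hnm
  · refine ⟨fun x => [l z x], (s z).image fun b => [b], ?_, fun x hx =>
      Finset.mem_image_of_mem _ (hls z x (hAW x hx)), fun x hx x' hx' h j hj =>
      hl z x x' (hAW x hx) (hAW x' hx') (by simpa using h) j (hj.trans_le hnm)⟩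
    refine le_trans (by exact_mod_cast Finset.card_image_le) ((hs z).trans ?_)
    have : (m z : ℝ) ≤ M := by exact_mod_cast hmM _
    gcongr
    linarith [(Nat.cast_nonneg n : (0 : ℝ) ≤ n)]
  · obtain ⟨L, T, hT, hLT, hL⟩ := ih (n - m z) (by have := hm z; omega) (f^[m z] '' A) (by
      rintro _ ⟨x, hx, rfl⟩ _ ⟨x', hx', rfl⟩ j hj
      rw [← Function.iterate_add_apply, ← Function.iterate_add_apply]
      exact hA x hx x' hx' _ (by omega))
    refine ⟨fun x => l z x :: L (f^[m z] x), ((s z) ×ˢ T).image fun q => q.1 :: q.2, ?_,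
      fun x hx => Finset.mem_image.2 ⟨(l z x, L (f^[m z] x)), Finset.mem_product.2
        ⟨hls z x (hAW x hx), hLT _ ⟨x, hx, rfl⟩⟩, rfl⟩, fun x hx x' hx' h j hj => ?_⟩
    · calc ((((s z) ×ˢ T).image fun q => q.1 :: q.2).card : ℝ)
          ≤ (((s z) ×ˢ T).card : ℝ) := by exact_mod_cast Finset.card_image_le
        _ = (s z).card * T.card := by rw [Finset.card_product]; push_cast; rfl
        _ ≤ Real.exp (δ * m z) * Real.exp (δ * ((n - m z : ℕ) + M)) := by
          gcongr
          exact hs z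
        _ = _ := by
          rw [← Real.exp_add, Nat.cast_sub hnm.le]
          ring_nf
    · simp only [List.cons.injEq] at h
      by_cases hjm : j < m z
      · exact hl z x x' (hAW x hx) (hAW x' hx') h.1 j hjm
      · obtain ⟨k, rfl⟩ := Nat.exists_eq_add_of_le (not_lt.1 hjm)
        rw [Nat.add_comm, Function.iterate_add_apply, Function.iterate_add_apply]
        exact hL _ ⟨x, hx, rfl⟩ _ ⟨x', hx', rfl⟩ h.2 k (by omega)

end Covers

lemma ncard_image_le_of_label {X α β : Type*} {A : Set X} {P : X → α} {L : X → β} {T : Finset β}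
    (hT : ∀ x ∈ A, L x ∈ T) (h : ∀ x ∈ A, ∀ y ∈ A, L x = L y → P x = P y) :
    (P '' A).ncard ≤ T.card := by
  obtain rfl | ⟨a, ha⟩ := A.eq_empty_or_nonempty
  · simp
  have : Nonempty X := ⟨a⟩
  choose! e he using fun v (hv : v ∈ P '' A) => hv
  rw [← Set.ncard_coe_finset]
  refine Set.ncard_le_ncard_of_injOn (L ∘ e) (fun v hv => hT _ (he v hv).1)
    (fun v hv w hw hvw => ?_) T.finite_toSet
  rw [← (he v hv).2, ← (he w hw).2]
  exact h _ (he v hv).1 _ (he w hw).1 hvw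

section Comparison

/-- A finite partition is determined, at a small enough scale, by a partition of small entropy
which records its value on the complement of compact cores of the atoms. -/
lemma exists_small_entropy_correction {X : Type*} [MetricSpace X] [CompactSpace X]
    [MeasurableSpace X] [BorelSpace X] {μ : Measure X} [IsProbabilityMeasure μ] {P : X → ℕ}
    (hP : Measurable P) (hPf : (range P).Finite) {δ : ℝ} (hδ : 0 < δ) :
    ∃ R : X → ℕ, Measurable R ∧ (range R).Finite ∧ partEntropy μ R ≤ δ ∧
      ∃ U ∈ uniformity X, ∀ x y, (x, y) ∈ U → R x = R y → P x = P y := by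
  classical
  set TP := hPf.toFinset with hTP
  have hP' : ∀ x, P x ∈ TP := fun x => by simp [hTP]
  set r : ℝ := (TP.card : ℝ)
  have hr0 : 0 ≤ r := Nat.cast_nonneg _
  obtain ⟨ε, hε, hε0, hε1⟩ : ∃ ε : ℝ, 0 < ε ∧
      (∀ a, 0 ≤ a → a ≤ ε → Real.negMulLog a ≤ δ / (r + 1)) ∧
      ∀ a, 0 ≤ a → a ≤ r * ε → Real.negMulLog (1 - a) ≤ δ / (r + 1) := by
    have hpos : 0 < δ / (r + 1) := by positivity
    have h0 := (Real.continuous_negMulLog.tendsto 0).eventually_le_const (by simpa using hpos)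
    have h1 := ((Real.continuous_negMulLog.comp (continuous_const.sub continuous_id :
      Continuous fun a : ℝ => 1 - a)).tendsto 0).eventually_le_const
        (by simpa using hpos)
    obtain ⟨e, he, h⟩ := Metric.eventually_nhds_iff.1 (h0.and h1)
    refine ⟨e / (r + 2), by positivity, fun a ha hae => (h ?_).1, fun a ha hae => (h ?_).2⟩
    · rw [Real.dist_eq, sub_zero, abs_of_nonneg ha]
      exact hae.trans_lt (div_lt_self he (by linarith))
    · rw [Real.dist_eq, sub_zero, abs_of_nonneg ha]
      refine hae.trans_lt ?_
      rw [← mul_div_assoc, div_lt_iff₀ (by positivity)]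
      nlinarith
  have hK : ∀ i, ∃ K ⊆ P ⁻¹' {i}, IsClosed K ∧ μ (P ⁻¹' {i} \ K) < ENNReal.ofReal ε := fun i =>
    (hP (measurableSet_singleton i)).exists_isClosed_sdiff_lt (measure_ne_top _ _)
      (by simpa using hε)
  choose K hKP hKc hKμ using hK
  let R : X → ℕ := fun x => if x ∈ ⋃ i ∈ TP, K i then 0 else P x + 1
  have hKR : ∀ x, R x = 0 → x ∈ K (P x) := fun x hx => by
    by_cases h : x ∈ ⋃ i ∈ TP, K i
    · obtain ⟨i, -, hi⟩ := mem_iUnion₂.1 h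
      rwa [show P x = i from hKP i hi]
    · exact absurd ((if_neg h).symm.trans hx) (P x).succ_ne_zero
  have hRK : ∀ x, x ∈ K (P x) → R x = 0 := fun x hx => if_pos (mem_iUnion₂.2 ⟨P x, hP' x, hx⟩)
  have hRP : ∀ x, R x ≠ 0 → R x = P x + 1 := fun x hx => by
    simp only [R] at hx ⊢
    split_ifs with h
    · simp [h] at hx
    · rfl
  have hRm : Measurable R := by
    refine Measurable.ite ?_ measurable_const (hP.add_const 1)
    exact Finset.measurableSet_biUnion _ fun i _ => (hKc i).measurableSet
  have hRT : ∀ x, R x ∈ insert 0 (TP.image (· + 1)) := fun x => by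
    by_cases h : R x = 0
    · simp [h]
    · rw [hRP x h]
      simp [hP' x]
  have hRi : ∀ i, R ⁻¹' {i + 1} = P ⁻¹' {i} \ K i := fun i => by
    ext x
    simp only [mem_preimage, mem_singleton_iff, Set.mem_sdiff]
    constructor
    · intro h
      have := hRP x (by omega)
      obtain rfl : P x = i := by omega
      exact ⟨rfl, fun hx => by have := hRK x hx; omega⟩
    · rintro ⟨rfl, h⟩
      exact hRP x fun h0 => h (hKR x h0)
  refine ⟨R, hRm, (Finset.finite_toSet _).subset (range_subset_iff.2 hRT), ?_,
    (⋃ i ∈ TP, ⋃ j ∈ TP.erase i, K i ×ˢ K j)ᶜ, ?_, fun x y hxy h => ?_⟩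
  · have hb : ∀ i, μ.real (R ⁻¹' {i + 1}) ≤ ε := fun i => by
      rw [hRi]
      exact ENNReal.toReal_le_of_le_ofReal hε.le (hKμ i).le
    have hsum := sum_measureReal_preimage (μ := μ) hRm hRT
    rw [Finset.sum_insert (by simp), Finset.sum_image (by simp)] at hsum
    rw [partEntropy_eq_sum hRT, Finset.sum_insert (by simp), Finset.sum_image (by simp)]
    have h0 : μ.real (R ⁻¹' {0}) = 1 - ∑ i ∈ TP, μ.real (R ⁻¹' {i + 1}) := by linarith
    have h1 : ∑ i ∈ TP, μ.real (R ⁻¹' {i + 1}) ≤ r * ε := by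
      simpa using Finset.sum_le_card_nsmul TP _ ε fun i _ => hb i
    have h2 : ∑ i ∈ TP, Real.negMulLog (μ.real (R ⁻¹' {i + 1})) ≤ r * (δ / (r + 1)) := by
      simpa using Finset.sum_le_card_nsmul TP _ (δ / (r + 1)) fun i _ =>
        hε0 _ measureReal_nonneg (hb i)
    have h3 := hε1 _ (Finset.sum_nonneg fun i _ => measureReal_nonneg) h1
    rw [h0]
    refine (add_le_add h3 h2).trans_eq ?_
    field_simp
    ring
  · rw [← nhdsSet_diagonal_eq_uniformity]
    refine IsOpen.mem_nhdsSet ?_ |>.2 ?_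
    · exact (isClosed_biUnion_finset fun i _ => isClosed_biUnion_finset fun j _ =>
        (hKc i).prod (hKc j)).isOpen_compl
    · rintro ⟨x, y⟩ hxy
      obtain rfl : x = y := hxy
      simp only [mem_compl_iff, mem_iUnion, not_exists]
      rintro i hi j hj ⟨h1, h2⟩
      exact (Finset.mem_erase.1 hj).1 ((show P x = j from hKP j h2).symm.trans (hKP i h1))
  · by_cases h0 : R x = 0
    · by_contra hne
      refine hxy (mem_iUnion₂.2 ⟨P x, hP' x, mem_iUnion₂.2 ⟨P y,
        Finset.mem_erase.2 ⟨Ne.symm hne, hP' y⟩, hKR x h0, hKR y (h ▸ h0)⟩⟩)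
    · have h1 := hRP x h0
      have h2 := hRP y (h ▸ h0)
      omega

variable {X Y : Type*} [MetricSpace X] [CompactSpace X] [MeasurableSpace X] [BorelSpace X]
  [MetricSpace Y] [CompactSpace Y] [MeasurableSpace Y] [BorelSpace Y]
  {f : X → X} {π : X → Y} {μ : Measure X} [IsProbabilityMeasure μ]

lemma exists_entropy_rate_le (hf : Continuous f) (hπ : Continuous π)
    (hfib : ∀ y : Y, Dynamics.coverEntropy f (π ⁻¹' {y}) ≤ 0) (hμ : MeasurePreserving f μ μ)
    {P : X → ℕ} (hP : Measurable P) (hPf : (range P).Finite) {δ : ℝ} (hδ : 0 < δ) :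
    ∃ Q : Y → ℕ, Measurable Q ∧ (range Q).Finite ∧
      ⨅ n : ℕ, partEntropy μ (refinePart f P n) / (n + 1)
        ≤ (⨅ n : ℕ, partEntropy μ (refinePart f (Q ∘ π) n) / (n + 1)) + 2 * δ := by
  have : Nonempty Y := (nonempty_of_isProbabilityMeasure μ).map π
  obtain ⟨R, hR, hRf, hRδ, U, hU, hRU⟩ := exists_small_entropy_correction (μ := μ) hP hPf hδ
  obtain ⟨Q, hQ, hQf, M, hM⟩ := exists_partition_labels hf hπ hfib hU hδ
  have hQπ : Measurable (Q ∘ π) := hQ.comp hπ.measurable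
  have hQπf : (range (Q ∘ π)).Finite := hQf.subset (range_comp_subset_range π Q)
  refine ⟨Q, hQ, hQf, ?_⟩
  have key : ∀ n : ℕ, partEntropy μ (refinePart f P n) ≤
      partEntropy μ (refinePart f (Q ∘ π) n) + (n + 1) * δ + δ * (n + 1 + M) := by
    intro n
    have m1 := measurable_refinePart hμ.measurable hQπ n
    have m2 := measurable_refinePart hμ.measurable hR n
    have r1 := finite_range_refinePart (f := f) hQπf n
    have r2 := finite_range_refinePart (f := f) hRf n
    have h1 := partEntropy_le_add_log (μ := μ) (measurable_pair m1 m2) (finite_range_pair r1 r2)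
      (measurable_refinePart hμ.measurable hP n) (finite_range_refinePart (f := f) hPf n)
      (Real.exp_pos (δ * (n + 1 + M))) fun s => by
        set A := (fun x => Nat.pair (refinePart f (Q ∘ π) n x) (refinePart f R n x)) ⁻¹' {s}
        have hAA : ∀ x ∈ A, ∀ y ∈ A, ∀ j ≤ n, Q (π (f^[j] x)) = Q (π (f^[j] y)) ∧
            R (f^[j] x) = R (f^[j] y) := fun x hx y hy j hj => by
          have h := Eq.trans hx (Eq.symm hy)
          simp only [Nat.pair_eq_pair, refinePart_eq_iff] at h
          exact ⟨h.1 j hj, h.2 j hj⟩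
        obtain ⟨L, T, hT, hLT, hL⟩ := hM (n + 1) A fun x hx y hy j hj =>
          (hAA x hx y hy j (by omega)).1
        refine le_trans (Nat.cast_le.2 (ncard_image_le_of_label hLT fun x hx y hy h => ?_))
          (by simpa using hT)
        rw [refinePart_eq_iff]
        exact fun j hj => hRU _ _ (hL x hx y hy h j (by omega)) (hAA x hx y hy j hj).2
    rw [Real.log_exp] at h1
    have h2 := partEntropy_pair_le (μ := μ) m1 r1 m2 r2
    have h3 := partEntropy_refinePart_le hμ hR hRf n
    have h4 : (n + 1 : ℝ) * partEntropy μ R ≤ (n + 1) * δ := by gcongr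
    linarith
  have hlim : Tendsto (fun n : ℕ => partEntropy μ (refinePart f (Q ∘ π) n) / (n + 1) + 2 * δ +
      δ * M * (1 / ((n : ℝ) + 1))) atTop
      (nhds ((⨅ n : ℕ, partEntropy μ (refinePart f (Q ∘ π) n) / (n + 1)) + 2 * δ +
        δ * M * 0)) :=
    ((tendsto_entropy_rate hμ hQπ hQπf).add_const _).add
      (tendsto_one_div_add_atTop_nhds_zero_nat.const_mul _)
  rw [mul_zero, add_zero] at hlim
  refine ge_of_tendsto' hlim fun n => (ciInf_le (bddBelow_entropy_rate f P) n).trans ?_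
  have hn : (0 : ℝ) < n + 1 := by positivity
  rw [div_le_iff₀ hn]
  refine (key n).trans_eq ?_
  field_simp
  ring

end Comparison

/-- If all fibers of a continuous semiconjugacy `π` carry zero topological
(Bowen) entropy, then every ergodic invariant probability measure has the same metric entropy
as its projection. -/
theorem entropy_eq_of_zero_entropy_fibers
    {X Y : Type*} [MetricSpace X] [CompactSpace X] [MeasurableSpace X] [BorelSpace X]
    [MetricSpace Y] [CompactSpace Y] [MeasurableSpace Y] [BorelSpace Y]
    (f : X → X) (g : Y → Y) (π : X → Y)
    (hf : Continuous f) (hg : Continuous g) (hπ : Continuous π)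
    (hsemi : π ∘ f = g ∘ π)
    (hfib : ∀ y : Y, Dynamics.coverEntropy f (π ⁻¹' {y}) = 0)
    (μ : Measure X) [IsProbabilityMeasure μ] (herg : Ergodic f μ) :
    kolSinai f μ = kolSinai g (Measure.map π μ) := by
  have hmap : ∀ (Q : Y → ℕ), Measurable Q → ∀ n : ℕ,
      partEntropy (μ.map π) (refinePart g Q n) = partEntropy μ (refinePart f (Q ∘ π) n) :=
    fun Q hQ n => partEntropy_refinePart_map hπ.measurable hg.measurable hsemi hQ n
  have hμ := herg.toMeasurePreserving
  set F : {P : X → ℕ // Measurable P ∧ (range P).Finite} → ℝ :=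
    fun P => ⨅ n : ℕ, partEntropy μ (refinePart f P.1 n) / (n + 1) with hF
  set G : {Q : Y → ℕ // Measurable Q ∧ (range Q).Finite} → ℝ :=
    fun Q => ⨅ n : ℕ, partEntropy (μ.map π) (refinePart g Q.1 n) / (n + 1) with hG
  change ⨆ P, F P = ⨆ Q, G Q
  have : Nonempty {P : X → ℕ // Measurable P ∧ (range P).Finite} :=
    ⟨⟨fun _ => 0, measurable_const, finite_range_const⟩⟩
  have : Nonempty {Q : Y → ℕ // Measurable Q ∧ (range Q).Finite} :=
    ⟨⟨fun _ => 0, measurable_const, finite_range_const⟩⟩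
  have hlift : ∀ Q, ∃ P, F P = G Q := fun Q => by
    refine ⟨⟨Q.1 ∘ π, Q.2.1.comp hπ.measurable, Q.2.2.subset (range_comp_subset_range π Q.1)⟩, ?_⟩
    simp only [hF, hG, hmap _ Q.2.1]
  have happrox : ∀ P, ∀ δ > 0, ∃ Q, F P ≤ G Q + 2 * δ := fun P δ hδ => by
    obtain ⟨Q, hQ, hQf, h⟩ := exists_entropy_rate_le hf hπ (fun y => (hfib y).le) hμ P.2.1 P.2.2 hδ
    refine ⟨⟨Q, hQ, hQf⟩, ?_⟩
    simpa only [hF, hG, hmap Q hQ] using h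
  by_cases hb : BddAbove (range G)
  · have hle : ∀ P, F P ≤ ⨆ Q, G Q := fun P => le_of_forall_pos_le_add fun ε hε => by
      obtain ⟨Q, hQ⟩ := happrox P (ε / 2) (by positivity)
      linarith [le_ciSup hb Q]
    refine le_antisymm (ciSup_le hle) (ciSup_le fun Q => ?_)
    obtain ⟨P, hP⟩ := hlift Q
    exact hP ▸ le_ciSup ⟨_, forall_mem_range.2 hle⟩ P
  · have hb' : ¬BddAbove (range F) := fun ⟨B, hB⟩ => hb ⟨B, forall_mem_range.2 fun Q => by
      obtain ⟨P, hP⟩ := hlift Q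
      exact hP ▸ hB ⟨P, rfl⟩⟩
    rw [Real.iSup_of_not_bddAbove hb, Real.iSup_of_not_bddAbove hb']
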